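/- arXiv:2304.02474 — 4 statements merged into one kernel-verified Lean document; each statement's English description precedes it below -/
import Mathlib

section
/- The series ∑_{k=1}^∞ (-1)^{k-1} ζ(2k)/(k(2k+1)) converges and equals 1 + 5π/12 − ln(2π) + (1/(2π))·Li₂(e^{−2π}). -/
open Real Complex

/-- The dilogarithm `Li₂(x) = ∑_{k≥1} x^k / k²`. -/
noncomputable def Li2 (x : ℝ) : ℝ := ∑' k : ℕ, x ^ (k + 1) / ((k : ℝ) + 1) ^ 2

noncomputable def ZZ (k : ℕ) : ℝ := ∑' n : ℕ, 1 / ((n : ℝ) + 1) ^ (2 * (k + 1))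

lemma ZZ_summable (k : ℕ) : Summable (fun n : ℕ => 1 / ((n : ℝ) + 1) ^ (2 * (k + 1))) := by
  have := (summable_nat_add_iff 1).mpr (Real.summable_one_div_nat_pow (p := 2 * (k + 1)) |>.mpr (by omega))
  exact_mod_cast this

lemma ZZ_zeta (k : ℕ) : riemannZeta (2 * ((k : ℂ) + 1)) = (ZZ k : ℂ) := by
  have h := zeta_eq_tsum_one_div_nat_add_one_cpow (s := ((2 * (k + 1) : ℕ) : ℂ)) (by
    rw [Complex.natCast_re]; exact_mod_cast (by omega : 1 < 2 * (k + 1)))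
  simp only [Complex.cpow_natCast] at h
  have e : (2 * ((k : ℂ) + 1)) = ((2 * (k + 1) : ℕ) : ℂ) := by push_cast; ring
  rw [e, h, ZZ, Complex.ofReal_tsum]
  push_cast
  rfl

lemma ZZ_nonneg (k : ℕ) : 0 ≤ ZZ k := tsum_nonneg fun n => by positivity

lemma ZZ_le (k : ℕ) : ZZ k ≤ ZZ 0 := by
  refine Summable.tsum_le_tsum (fun n => ?_) (ZZ_summable k) (ZZ_summable 0)
  have : (1 : ℝ) ≤ (n : ℝ) + 1 := by linarith [Nat.cast_nonneg (α := ℝ) n]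
  gcongr
  omega

lemma sinh_sum {x : ℝ} (hx : 0 < x) :
    HasSum (fun n : ℕ => Real.log (1 + x ^ 2 / ((n : ℝ) + 1) ^ 2))
      (Real.log (Real.sinh (π * x) / (π * x))) := by
  have hpx : 0 < π * x := mul_pos Real.pi_pos hx
  rw [hasSum_iff_tendsto_nat_of_nonneg (fun i => Real.log_nonneg (by
    have : 0 ≤ x ^ 2 / ((i : ℝ) + 1) ^ 2 := by positivity
    linarith))]
  have h := Complex.tendsto_euler_sin_prod (x * I)
  have h2 : Filter.Tendsto (fun n : ℕ => π * x * ∏ j ∈ Finset.range n, ((1 : ℝ) + x ^ 2 / ((j : ℝ) + 1) ^ 2))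
      Filter.atTop (nhds (Real.sinh (π * x))) := by
    have h3 := (Complex.continuous_im.tendsto _).comp h
    have e1 : (Complex.sin (π * (x * I))).im = Real.sinh (π * x) := by
      rw [← mul_assoc, Complex.sin_mul_I, ← Complex.ofReal_mul, ← Complex.ofReal_sinh, Complex.im_ofReal_mul]
      simp
    rw [e1] at h3
    refine h3.congr fun n => ?_
    have e2 : (π * (x * I) * ∏ j ∈ Finset.range n, ((1 : ℂ) - (x * I) ^ 2 / ((j : ℂ) + 1) ^ 2))
      = ((π * x * ∏ j ∈ Finset.range n, ((1 : ℝ) + x ^ 2 / ((j : ℝ) + 1) ^ 2) : ℝ) : ℂ) * I := by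
      push_cast
      simp only [mul_pow, Complex.I_sq]
      have : ∀ j : ℕ, (1 : ℂ) - x ^ 2 * -1 / ((j : ℂ) + 1) ^ 2 = 1 + x ^ 2 / ((j : ℂ) + 1) ^ 2 := by
        intro j; ring
      simp only [this]
      ring
    simp only [Function.comp]
    rw [e2, Complex.im_ofReal_mul]
    simp
  have h4 := (h2.div_const (π * x)).log (by
    have := Real.sinh_pos_iff.mpr hpx
    positivity)
  refine h4.congr fun n => ?_
  rw [mul_div_cancel_left₀ _ hpx.ne', Real.log_prod]
  intro j _
  positivity

lemma stepA {x : ℝ} (hx : 0 < x) (hx1 : x < 1) :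
    HasSum (fun k : ℕ => (-1 : ℝ) ^ k * ZZ k * x ^ (2 * (k + 1)) / ((k : ℝ) + 1))
      (Real.log (Real.sinh (π * x) / (π * x))) := by
  set F : ℕ × ℕ → ℝ := fun p => (-1 : ℝ) ^ p.2 * (x ^ (2 * (p.2 + 1)) / ((p.2 : ℝ) + 1)) *
    (1 / ((p.1 : ℝ) + 1) ^ (2 * (p.2 + 1))) with hF
  have hg : Summable (fun k : ℕ => (x ^ 2) ^ (k + 1)) :=
    (summable_nat_add_iff 1).mpr (summable_geometric_of_lt_one (by positivity) (by nlinarith))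
  have hS : Summable F := by
    refine Summable.of_norm_bounded (Summable.mul_of_nonneg (ZZ_summable 0) hg
      (fun _ => by positivity) (fun _ => by positivity)) ?_
    rintro ⟨n, k⟩
    simp only [hF]
    rw [norm_mul, norm_mul, norm_pow, norm_neg, norm_one, one_pow, one_mul, mul_comm,
      Real.norm_of_nonneg (by positivity), Real.norm_of_nonneg (by positivity)]
    have : (1 : ℝ) ≤ (n : ℝ) + 1 := by linarith [Nat.cast_nonneg (α := ℝ) n]
    rw [pow_mul x]
    have h2 : (x ^ 2) ^ (k + 1) / ((k : ℝ) + 1) ≤ (x ^ 2) ^ (k + 1) :=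
      div_le_self (by positivity) (by linarith [Nat.cast_nonneg (α := ℝ) k])
    have h3 : 1 / ((n : ℝ) + 1) ^ (2 * (k + 1)) ≤ 1 / ((n : ℝ) + 1) ^ (2 * (0 + 1)) := by
      gcongr
      omega
    exact mul_le_mul h3 h2 (by positivity) (by positivity)
  have hrow : ∀ n : ℕ, HasSum (fun k => F (n, k)) (Real.log (1 + x ^ 2 / ((n : ℝ) + 1) ^ 2)) := by
    intro n
    have hn : (1 : ℝ) ≤ ((n : ℝ) + 1) ^ 2 := by
      have := Nat.cast_nonneg (α := ℝ) n
      nlinarith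
    have hlt : x ^ 2 / ((n : ℝ) + 1) ^ 2 < 1 := by
      rw [div_lt_one (by positivity)]; nlinarith
    have h0 : 0 ≤ x ^ 2 / ((n : ℝ) + 1) ^ 2 := by positivity
    have := (Real.hasSum_pow_div_log_of_abs_lt_one (x := -(x ^ 2 / ((n : ℝ) + 1) ^ 2))
      (by rw [abs_neg, abs_of_nonneg h0]; exact hlt)).neg
    rw [neg_neg, sub_neg_eq_add] at this
    convert! this using 1
    ext k
    simp only [hF]
    rw [neg_pow (x ^ 2 / ((n : ℝ) + 1) ^ 2), div_pow, pow_mul, pow_mul, pow_succ (-1 : ℝ)]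
    field_simp
  have htot := hS.hasSum.prod_fiberwise hrow
  have heq := htot.unique (sinh_sum hx)
  have hS2 := (Equiv.prodComm ℕ ℕ).hasSum_iff.mpr hS.hasSum
  rw [heq] at hS2
  refine (hS2.prod_fiberwise (g := fun k : ℕ => (-1 : ℝ) ^ k * ZZ k * x ^ (2 * (k + 1)) / ((k : ℝ) + 1)) ?_)
  intro k
  have := (ZZ_summable k).hasSum.mul_left ((-1 : ℝ) ^ k * (x ^ (2 * (k + 1)) / ((k : ℝ) + 1)))
  convert! this using 1
  rw [ZZ]; ring

noncomputable def hh (k : ℕ) (x : ℝ) : ℝ :=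
  (-1 : ℝ) ^ k * ZZ k * x ^ (2 * (k + 1)) / ((k : ℝ) + 1) +
    Real.exp (-(2 * π * (k + 1)) * x) / ((k : ℝ) + 1)

lemma hh_sum {x : ℝ} (hx : 0 < x) (hx1 : x < 1) :
    HasSum (fun k => hh k x) (π * x - Real.log (2 * π) - Real.log x) := by
  have hpx : 0 < π * x := mul_pos Real.pi_pos hx
  have hlt : Real.exp (-(2 * π * x)) < 1 := by rw [Real.exp_lt_one_iff]; nlinarith
  have h1 := Real.hasSum_pow_div_log_of_abs_lt_one (x := Real.exp (-(2 * π * x)))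
    (by rw [abs_of_pos (Real.exp_pos _)]; exact hlt)
  convert! (stepA hx hx1).add h1 using 1
  · ext k
    rw [hh, ← Real.exp_nat_mul]
    congr 3
    push_cast; ring_nf
  · have e : Real.sinh (π * x) = Real.exp (π * x) * (1 - Real.exp (-(2 * π * x))) / 2 := by
      rw [Real.sinh_eq, mul_sub, ← Real.exp_add]; ring_nf
    have : 1 - Real.exp (-(2 * π * x)) ≠ 0 := by linarith
    have hp := Real.pi_pos.ne'
    rw [e, Real.log_div (by positivity) hpx.ne', Real.log_div (by positivity) (by norm_num),
      Real.log_mul (by positivity) this, Real.log_exp, Real.log_mul hp hx.ne',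
      Real.log_mul (by norm_num) hp]
    ring

lemma int_exp (k : ℕ) (c : ℝ) : ∫ x in (0 : ℝ)..1, (c * x ^ (2 * (k + 1)) / ((k : ℝ) + 1) +
    Real.exp (-(2 * π * (k + 1)) * x) / ((k : ℝ) + 1)) =
    c / (((k : ℝ) + 1) * (2 * ((k : ℝ) + 1) + 1)) +
      (1 - Real.exp (-2 * π) ^ (k + 1)) / (2 * π * ((k : ℝ) + 1) ^ 2) := by
  have hp := Real.pi_pos
  have hk : (0 : ℝ) < (k : ℝ) + 1 := by positivity
  rw [intervalIntegral.integral_add (Continuous.intervalIntegrable (by fun_prop) _ _)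
    (Continuous.intervalIntegrable (by fun_prop) _ _), intervalIntegral.integral_div,
    intervalIntegral.integral_const_mul, intervalIntegral.integral_div, integral_pow,
    intervalIntegral.integral_comp_mul_left (fun x => Real.exp x) (by nlinarith [mul_pos hp hk]), integral_exp,
    ← Real.exp_nat_mul]
  have : ((k + 1 : ℕ) : ℝ) * (-2 * π) = -(2 * π * (k + 1)) * 1 := by push_cast; ring
  rw [this]
  push_cast
  simp only [one_pow, mul_zero, Real.exp_zero, smul_eq_mul]
  rw [zero_pow (by omega)]
  field_simp
  ring

lemma sum_sq : HasSum (fun k : ℕ => 1 / ((k : ℝ) + 1) ^ 2) (π ^ 2 / 6) := by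
  have := (hasSum_nat_add_iff' 1).mpr hasSum_zeta_two
  simpa using this

lemma main_real : HasSum (fun k : ℕ => (-1 : ℝ) ^ k * ZZ k / (((k : ℝ) + 1) * (2 * ((k : ℝ) + 1) + 1)))
    (1 + 5 * π / 12 - Real.log (2 * π) + (1 / (2 * π)) * Li2 (Real.exp (-2 * π))) := by
  have hp := Real.pi_pos
  have hconv : ∀ f : ℝ → ℝ, ∫ x in (0 : ℝ)..1, f x = ∫ x in Set.Ioo (0 : ℝ) 1, f x := fun f => by
    rw [intervalIntegral.integral_of_le zero_le_one, MeasureTheory.integral_Ioc_eq_integral_Ioo]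
  have hcontint : ∀ f : ℝ → ℝ, Continuous f → MeasureTheory.IntegrableOn f (Set.Ioo (0 : ℝ) 1) :=
    fun f hf => (hf.integrableOn_Icc (a := 0) (b := 1)).mono_set Set.Ioo_subset_Icc_self
  have hcont : ∀ k, Continuous (hh k) := fun k => by unfold hh; fun_prop
  have hexp1 : Real.exp (-2 * π) ≤ 1 := Real.exp_le_one_iff.mpr (by linarith)
  have hsum := MeasureTheory.hasSum_integral_of_summable_integral_norm
    (μ := MeasureTheory.volume.restrict (Set.Ioo (0 : ℝ) 1)) (F := hh)
    (fun k => hcontint _ (hcont k)) (by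
      refine Summable.of_nonneg_of_le (fun k => MeasureTheory.integral_nonneg fun _ => norm_nonneg _)
        (fun k => ?_) (sum_sq.summable.mul_left (ZZ 0 + 1))
      have hk : (0 : ℝ) < (k : ℝ) + 1 := by positivity
      have hb : ∫ x in Set.Ioo (0 : ℝ) 1, ‖hh k x‖ ≤ ∫ x in Set.Ioo (0 : ℝ) 1,
          (ZZ k * x ^ (2 * (k + 1)) / ((k : ℝ) + 1) +
            Real.exp (-(2 * π * (k + 1)) * x) / ((k : ℝ) + 1)) := by
        refine MeasureTheory.setIntegral_mono_on (hcontint _ (hcont k).norm)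
          (hcontint _ (by fun_prop)) measurableSet_Ioo fun x hx => ?_
        refine (norm_add_le _ _).trans (le_of_eq ?_)
        have := ZZ_nonneg k
        have := hx.1
        rw [norm_div, norm_mul, norm_mul, norm_pow, norm_neg, norm_one, one_pow, one_mul,
          Real.norm_of_nonneg (ZZ_nonneg k), Real.norm_of_nonneg (by positivity),
          Real.norm_of_nonneg hk.le, Real.norm_of_nonneg (by positivity)]
      refine hb.trans ?_
      rw [← hconv, int_exp]
      have h1 : ZZ k / (((k : ℝ) + 1) * (2 * ((k : ℝ) + 1) + 1)) ≤ ZZ 0 * (1 / ((k : ℝ) + 1) ^ 2) := by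
        rw [mul_one_div]
        exact div_le_div₀ (ZZ_nonneg 0) (ZZ_le k) (by positivity) (by nlinarith)
      have h2 : (1 - Real.exp (-2 * π) ^ (k + 1)) / (2 * π * ((k : ℝ) + 1) ^ 2) ≤ 1 / ((k : ℝ) + 1) ^ 2 := by
        have : 0 < Real.exp (-2 * π) ^ (k + 1) := by positivity
        refine div_le_div₀ zero_le_one (by linarith) (by positivity) ?_
        have : (0 : ℝ) < ((k : ℝ) + 1) ^ 2 := by positivity
        nlinarith [Real.pi_gt_three]
      linarith)
  have hval : ∫ x in Set.Ioo (0 : ℝ) 1, (∑' k, hh k x) = π / 2 - Real.log (2 * π) + 1 := by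
    rw [MeasureTheory.setIntegral_congr_fun measurableSet_Ioo
      (fun x hx => (hh_sum hx.1 hx.2).tsum_eq), ← hconv,
      intervalIntegral.integral_sub (Continuous.intervalIntegrable (by fun_prop) _ _)
        intervalIntegral.intervalIntegrable_log',
      intervalIntegral.integral_sub (Continuous.intervalIntegrable (by fun_prop) _ _)
        (Continuous.intervalIntegrable (by fun_prop) _ _), integral_log,
      intervalIntegral.integral_const_mul, integral_id, intervalIntegral.integral_const]
    simp
    ring
  rw [hval] at hsum
  have hLi : HasSum (fun k : ℕ => Real.exp (-2 * π) ^ (k + 1) / ((k : ℝ) + 1) ^ 2) (Li2 (Real.exp (-2 * π))) := by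
    refine Summable.hasSum (Summable.of_nonneg_of_le (fun k => by positivity) (fun k => ?_) sum_sq.summable)
    gcongr
    exact pow_le_one₀ (Real.exp_pos _).le hexp1
  have hfin := hsum.sub ((sum_sq.sub hLi).mul_left (1 / (2 * π)))
  convert! hfin using 1
  · ext k
    rw [← hconv]
    simp only [hh]
    rw [int_exp]
    field_simp
    ring
  · field_simp
    ring

theorem stmt0 :
    HasSum (fun k : ℕ =>
      (-1 : ℂ) ^ k * riemannZeta (2 * ((k : ℂ) + 1)) / (((k : ℂ) + 1) * (2 * ((k : ℂ) + 1) + 1)))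
      (1 + 5 * (π : ℂ) / 12 - Real.log (2 * π) + (1 / (2 * (π : ℂ))) * Li2 (Real.exp (-2 * π))) := by
  have h := Complex.hasSum_ofReal.mpr main_real
  convert! h using 1
  · ext k
    rw [ZZ_zeta]
    push_cast
    rfl
  · push_cast
    rfl
end

section
/- ∑_{k=1}^∞ ζ(2k)/(k(k+2)) = −1/8 + ln(2π)/2 + 3ζ(3)/(2π²). -/
open Real Complex
open Filter Topology MeasureTheory

lemma my_hasSum_congr {f g : ℕ → ℝ} {a : ℝ} (h : ∀ n, f n = g n) : HasSum f a ↔ HasSum g a := by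
  rw [funext h]

lemma aux_fourier (r θ : ℝ) (h0 : 0 ≤ r) (h1 : r < 1) :
    HasSum (fun n : ℕ => r ^ n / n * Real.cos (n * θ))
      (-(1/2) * Real.log ((1 - r) ^ 2 + 4 * r * Real.sin (θ / 2) ^ 2)) := by
  have hz : ‖(r : ℂ) * Complex.exp (θ * I)‖ < 1 := by
    rw [norm_mul, Complex.norm_exp_ofReal_mul_I]
    simp [abs_of_nonneg h0, h1]
  have h := Complex.hasSum_re (Complex.hasSum_taylorSeries_neg_log hz)
  convert h using 1
  · ext n
    rw [mul_pow, ← Complex.exp_nat_mul, ← Complex.ofReal_pow]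
    rw [show (n : ℂ) * (θ * I) = ((n * θ : ℝ) : ℂ) * I by push_cast; ring]
    rw [mul_div_right_comm, ← Complex.ofReal_natCast, ← Complex.ofReal_div, Complex.re_ofReal_mul,
      Complex.exp_ofReal_mul_I_re]
  · rw [Complex.neg_re, Complex.log_re]
    have : (1 - r) ^ 2 + 4 * r * Real.sin (θ / 2) ^ 2 = ‖1 - (r : ℂ) * Complex.exp (θ * I)‖ ^ 2 := by
      rw [Complex.sq_norm, Complex.normSq_apply]
      simp only [Complex.sub_re, Complex.sub_im, Complex.re_ofReal_mul, Complex.im_ofReal_mul,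
        Complex.exp_ofReal_mul_I_re, Complex.exp_ofReal_mul_I_im, Complex.one_re, Complex.one_im]
      have e1 : Real.cos θ = 1 - 2 * Real.sin (θ/2)^2 := by
        rw [← Real.cos_sq_add_sin_sq (θ/2)]
        nth_rw 1 [show θ = 2 * (θ / 2) by ring]
        rw [Real.cos_two_mul, ← Real.cos_sq_add_sin_sq (θ/2)]; nlinarith [Real.cos_sq_add_sin_sq (θ/2)]
      have e2 := Real.cos_sq_add_sin_sq θ
      have e3 : Real.sin (θ/2)^2 = (1 - Real.cos θ)/2 := by linarith
      rw [e3]; linear_combination (-r^2) * e2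
    rw [this, Real.log_pow]; push_cast; ring

lemma aux_int (n : ℕ) (hn : n ≠ 0) :
    ∫ x in (0:ℝ)..1, x ^ 3 * Real.cos (n * (2 * π * x)) = 3 / (4 * π ^ 2 * n ^ 2) := by
  set a : ℝ := 2 * π * n with ha
  have hn' : (n : ℝ) ≠ 0 := by exact_mod_cast hn
  have ha0 : a ≠ 0 := by positivity
  have hd : ∀ x ∈ Set.uIcc (0:ℝ) 1, HasDerivAt (fun x : ℝ => x^3 / a * Real.sin (a * x)
      + 3 * x^2 / a^2 * Real.cos (a*x) - 6 * x / a^3 * Real.sin (a * x) - 6 / a^4 * Real.cos (a*x))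
      (x ^ 3 * Real.cos (n * (2 * π * x))) x := by
    intro x _
    have hax : HasDerivAt (fun x : ℝ => a * x) a x := by simpa using (hasDerivAt_id x).const_mul a
    have hs := hax.sin
    have hc := hax.cos
    have h := (((((hasDerivAt_pow 3 x).div_const a).mul hs).add
      ((((hasDerivAt_pow 2 x).const_mul 3).div_const (a^2)).mul hc)).sub
      ((((hasDerivAt_id x).const_mul 6).div_const (a^3)).mul hs)).sub (hc.const_mul (6/a^4))
    refine h.congr_deriv ?_
    rw [show (n : ℝ) * (2 * π * x) = a * x by rw [ha]; ring]
    simp only [id]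
    field_simp
    norm_num
    ring
  rw [intervalIntegral.integral_eq_sub_of_hasDerivAt hd
    ((by fun_prop : Continuous _).intervalIntegrable _ _)]
  have hc : Real.cos a = 1 := by rw [ha, mul_comm]; exact Real.cos_nat_mul_two_pi n
  have hs : Real.sin a = 0 := by
    rw [ha, show 2 * π * n = ((2 * n : ℕ) : ℝ) * π by push_cast; ring]; exact Real.sin_nat_mul_pi _
  simp [hc, hs]
  rw [ha]; field_simp; norm_num

lemma log_sin_int : IntervalIntegrable (fun x : ℝ => Real.log (Real.sin (π * x))) volume 0 1 := by
  have := (intervalIntegrable_log_sin (a := 0) (b := π)).comp_mul_left (c := π)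
  simpa [Real.pi_ne_zero] using this

lemma aux_abel (r : ℝ) (h0 : 0 ≤ r) (h1 : r < 1) :
    HasSum (fun n : ℕ => r ^ n * (3 / (4 * π ^ 2) * (1 / (n:ℝ) ^ 3)))
      (∫ x in (0:ℝ)..1, x ^ 3 * (-(1/2) * Real.log ((1 - r) ^ 2 + 4 * r * Real.sin (π * x) ^ 2))) := by
  have hg := summable_geometric_of_lt_one h0 h1
  have h := intervalIntegral.hasSum_integral_of_dominated_convergence (μ := volume) (a := 0) (b := 1)
    (F := fun (n : ℕ) (x : ℝ) => x ^ 3 * (r ^ n / n * Real.cos (n * (2 * π * x))))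
    (f := fun x => x ^ 3 * (-(1/2) * Real.log ((1 - r) ^ 2 + 4 * r * Real.sin (π * x) ^ 2)))
    (fun n _ => r ^ n) ?_ ?_ ?_ ?_ ?_
  · refine (my_hasSum_congr fun n => ?_).mpr h
    rcases eq_or_ne n 0 with rfl | hn
    · simp
    · rw [show (fun x : ℝ => x ^ 3 * (r ^ n / n * Real.cos (n * (2 * π * x)))) =
        fun x => (r ^ n / n) * (x ^ 3 * Real.cos (n * (2 * π * x))) by ext x; ring]
      rw [intervalIntegral.integral_const_mul, aux_int n hn]
      have hn' : (n : ℝ) ≠ 0 := by exact_mod_cast hn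
      field_simp
  · intro n
    exact (by fun_prop : Continuous _).aestronglyMeasurable
  · intro n
    refine Eventually.of_forall fun x hx => ?_
    rw [Set.uIoc_of_le zero_le_one] at hx
    have hx3 : x ^ 3 ≤ 1 := pow_le_one₀ hx.1.le hx.2
    have hx3' : 0 ≤ x ^ 3 := pow_nonneg hx.1.le 3
    rw [norm_mul, norm_mul, Real.norm_eq_abs, Real.norm_eq_abs, Real.norm_eq_abs,
      abs_of_nonneg hx3', abs_of_nonneg (by positivity : 0 ≤ r ^ n / (n:ℝ))]
    have hr : 0 ≤ r ^ n := by positivity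
    have hd : r ^ n / n ≤ r ^ n := by
      rcases eq_or_ne n 0 with rfl | hn
      · simp
      · exact div_le_self hr (by exact_mod_cast Nat.one_le_iff_ne_zero.mpr hn)
    calc x ^ 3 * (r ^ n / n * |Real.cos (n * (2 * π * x))|) ≤ 1 * (r ^ n * 1) := by
          gcongr
          exact Real.abs_cos_le_one _
      _ = r ^ n := by ring
  · exact Eventually.of_forall fun x hx => hg
  · exact intervalIntegrable_const
  · refine Eventually.of_forall fun x hx => ?_
    have := (aux_fourier r (2 * π * x) h0 h1).mul_left (x ^ 3)
    rwa [show 2 * π * x / 2 = π * x by ring] at this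

lemma aux_sin_pos {x : ℝ} (h0 : 0 < x) (h1 : x < 1) : 0 < Real.sin (π * x) :=
  Real.sin_pos_of_pos_of_lt_pi (by positivity) (by nlinarith [Real.pi_pos])

lemma ae_lt_one : ∀ᵐ x : ℝ, x ∈ Set.uIoc (0:ℝ) 1 → 0 < x ∧ x < 1 := by
  have : ∀ᵐ x : ℝ, x ≠ 1 := by simp [ae_iff]
  filter_upwards [this] with x hx h
  rw [Set.uIoc_of_le zero_le_one] at h
  exact ⟨h.1, lt_of_le_of_ne h.2 hx⟩

lemma int_log_sin :
    ∫ x in (0:ℝ)..1, x ^ 3 * (-(1/2) * Real.log (4 * Real.sin (π * x) ^ 2)) =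
      3 / (4 * π ^ 2) * ∑' n : ℕ, 1 / (n:ℝ) ^ 3 := by
  have hsum : Summable (fun n : ℕ => 3 / (4 * π ^ 2) * (1 / (n:ℝ) ^ 3)) :=
    (Real.summable_one_div_nat_pow.mpr (by norm_num)).mul_left _
  have hev : ∀ᶠ r : ℝ in 𝓝[<] 1, 1/2 ≤ r ∧ r < 1 := by
    filter_upwards [Ioo_mem_nhdsLT (show (1/2:ℝ) < 1 by norm_num)] with r hr
    exact ⟨hr.1.le, hr.2⟩
  have hlim : Tendsto (fun r : ℝ => r) (𝓝[<] 1) (𝓝 1) := nhdsWithin_le_nhds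
  have t1 : Tendsto (fun r : ℝ => ∑' n : ℕ, r ^ n * (3 / (4 * π ^ 2) * (1 / (n:ℝ) ^ 3))) (𝓝[<] 1)
      (𝓝 (∑' n : ℕ, (3 / (4 * π ^ 2) * (1 / (n:ℝ) ^ 3)))) := by
    refine tendsto_tsum_of_dominated_convergence hsum ?_ ?_
    · intro n
      have := (hlim.pow n).mul_const (3 / (4 * π ^ 2) * (1 / (n:ℝ) ^ 3))
      rwa [one_pow, one_mul] at this
    · filter_upwards [hev] with r hr n
      have h3 : 0 ≤ (3 / (4 * π ^ 2) * (1 / (n:ℝ) ^ 3)) := by positivity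
      have hr0 : 0 ≤ r := by linarith [hr.1]
      rw [Real.norm_eq_abs, abs_of_nonneg (by positivity)]
      exact mul_le_of_le_one_left h3 (pow_le_one₀ hr0 hr.2.le)
  have t2 : Tendsto (fun r : ℝ => ∫ x in (0:ℝ)..1, x ^ 3 *
      (-(1/2) * Real.log ((1 - r) ^ 2 + 4 * r * Real.sin (π * x) ^ 2))) (𝓝[<] 1)
      (𝓝 (∫ x in (0:ℝ)..1, x ^ 3 * (-(1/2) * Real.log (4 * Real.sin (π * x) ^ 2)))) := by
    refine intervalIntegral.tendsto_integral_filter_of_dominated_convergence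
      (fun x => |Real.log (Real.sin (π * x))| + 2) ?_ ?_ ?_ ?_
    · refine Eventually.of_forall fun r => ?_
      exact (by fun_prop : Measurable _).aestronglyMeasurable
    · filter_upwards [hev] with r hr
      filter_upwards [ae_lt_one] with x hx hx'
      obtain ⟨hx0, hx1⟩ := hx hx'
      have hs := aux_sin_pos hx0 hx1
      have hs1 := Real.sin_le_one (π * x)
      set s := Real.sin (π * x)
      have l1 : s ^ 2 ≤ (1 - r) ^ 2 + 4 * r * s ^ 2 := by nlinarith [sq_nonneg s, sq_nonneg (1-r)]
      have l2 : (1 - r) ^ 2 + 4 * r * s ^ 2 ≤ 5 := by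
        have : s ^ 2 ≤ 1 := by nlinarith
        nlinarith [sq_nonneg s]
      have hp : 0 < s ^ 2 := by positivity
      have m1 := Real.log_le_log hp l1
      rw [Real.log_pow] at m1
      have m2 := Real.log_le_sub_one_of_pos (hp.trans_le l1)
      have hx3 : |x ^ 3| ≤ 1 := by
        rw [abs_of_nonneg (by positivity)]; exact pow_le_one₀ hx0.le hx1.le
      rw [norm_mul, Real.norm_eq_abs, Real.norm_eq_abs]
      have : |(-(1/2) * Real.log ((1 - r) ^ 2 + 4 * r * s ^ 2))| ≤ |Real.log s| + 2 := by
        have := neg_abs_le (Real.log s)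
        have := abs_nonneg (Real.log s)
        push_cast at m1
        rw [abs_le]; constructor <;> linarith
      calc _ ≤ 1 * (|Real.log s| + 2) := by gcongr
        _ = _ := one_mul _
    · exact log_sin_int.abs.add intervalIntegrable_const
    · filter_upwards [ae_lt_one] with x hx hx'
      obtain ⟨hx0, hx1⟩ := hx hx'
      have hs := aux_sin_pos hx0 hx1
      refine Tendsto.const_mul _ (Tendsto.const_mul _ ?_)
      refine Tendsto.log ?_ (by positivity)
      have : Tendsto (fun r : ℝ => (1 - r) ^ 2 + 4 * r * Real.sin (π * x) ^ 2) (𝓝[<] 1)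
        (𝓝 ((1 - 1) ^ 2 + 4 * 1 * Real.sin (π * x) ^ 2)) :=
        ((tendsto_const_nhds.sub hlim).pow 2).add ((hlim.const_mul 4).mul_const _)
      simpa using this
  rw [← tsum_mul_left]
  refine tendsto_nhds_unique t2 (t1.congr' ?_)
  filter_upwards [hev] with r hr
  exact (aux_abel r (by linarith [hr.1]) hr.2).tsum_eq

lemma int_log : ∫ x in (0:ℝ)..1, x ^ 3 * Real.log x = -(1/16) := by
  have hi : IntervalIntegrable (fun x : ℝ => x ^ 3 * Real.log x) volume 0 1 :=
    intervalIntegral.intervalIntegrable_log'.continuousOn_mul (by fun_prop)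
  have := intervalIntegral.integral_eq_sub_of_hasDeriv_right (a := 0) (b := 1)
    (f := fun x : ℝ => x ^ 3 / 4 * (x * Real.log x) - x ^ 4 / 16)
    (f' := fun x : ℝ => x ^ 3 * Real.log x) ?_ ?_ hi
  · rw [this]; norm_num
  · have := Real.continuous_mul_log
    exact Continuous.continuousOn (by fun_prop)
  · intro x hx
    simp at hx
    have hx0 : x ≠ 0 := hx.1.ne'
    refine HasDerivAt.hasDerivWithinAt ?_
    have h := (((hasDerivAt_pow 3 x).div_const 4).mul (Real.hasDerivAt_mul_log hx0)).sub
      ((hasDerivAt_pow 4 x).div_const 16)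
    refine h.congr_deriv ?_
    push_cast; ring

noncomputable def zz (k : ℕ) : ℝ := ∑' j : ℕ, 1 / ((j:ℝ) + 1) ^ (2 * k + 2)

lemma sum_j (m : ℕ) (hm : 1 < m) : Summable (fun j : ℕ => 1 / ((j:ℝ) + 1) ^ m) := by
  have := (summable_nat_add_iff 1).mpr (Real.summable_one_div_nat_pow.mpr hm)
  simpa using this

lemma hasSum_L {x : ℝ} (h0 : 0 < x) (h1 : x < 1) :
    HasSum (fun k : ℕ => zz k * x ^ (2 * k + 2) / (k + 1))
      (Real.log (π * x) - Real.log (Real.sin (π * x))) := by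
  have hs := aux_sin_pos h0 h1
  set f : ℕ × ℕ → ℝ := fun p => (x ^ 2 / ((p.1:ℝ) + 1) ^ 2) ^ (p.2 + 1) / (p.2 + 1) with hf
  have hx2 : x ^ 2 < 1 := by nlinarith
  have hq : ∀ j : ℕ, x ^ 2 / ((j:ℝ) + 1) ^ 2 < 1 := fun j => by
    refine lt_of_le_of_lt (div_le_self (by positivity) ?_) hx2
    exact one_le_pow₀ (by linarith [Nat.cast_nonneg (α := ℝ) j])
  have hsum : Summable f := by
    refine Summable.of_nonneg_of_le (fun p => by positivity) (fun p => ?_)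
      ((sum_j 2 (by norm_num)).mul_of_nonneg (summable_geometric_of_lt_one (by positivity) hx2)
        (fun _ => by positivity) (fun _ => by positivity))
    simp only [hf]
    calc (x ^ 2 / ((p.1:ℝ) + 1) ^ 2) ^ (p.2 + 1) / (p.2 + 1)
        ≤ (x ^ 2 / ((p.1:ℝ) + 1) ^ 2) ^ (p.2 + 1) :=
          div_le_self (by positivity) (by linarith [Nat.cast_nonneg (α := ℝ) p.2])
      _ = (x ^ 2 / ((p.1:ℝ) + 1) ^ 2) ^ p.2 * (x ^ 2 / ((p.1:ℝ) + 1) ^ 2) := pow_succ _ _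
      _ ≤ (x ^ 2) ^ p.2 * (1 / ((p.1:ℝ) + 1) ^ 2) := by
          gcongr
          exact div_le_self (by positivity)
            (one_le_pow₀ (by linarith [Nat.cast_nonneg (α := ℝ) p.1]))
      _ = _ := mul_comm _ _
  have hrow : ∀ j : ℕ, HasSum (fun k => f (j, k)) (-Real.log (1 - x ^ 2 / ((j:ℝ) + 1) ^ 2)) := by
    intro j
    refine Real.hasSum_pow_div_log_of_abs_lt_one (x := x ^ 2 / ((j:ℝ) + 1) ^ 2) ?_
    rw [abs_of_nonneg (by positivity)]
    exact hq j
  have hcol : ∀ k : ℕ, HasSum (fun j => f (j, k)) (zz k * x ^ (2 * k + 2) / (k + 1)) := by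
    intro k
    have := ((sum_j (2 * k + 2) (by omega)).hasSum.mul_right (x ^ (2 * k + 2))).div_const ((k:ℝ) + 1)
    refine (my_hasSum_congr fun j => ?_).mpr this
    simp only [hf]
    rw [div_pow, ← pow_mul, ← pow_mul]
    ring
  have hA := hsum.hasSum.prod_fiberwise hrow
  have hB := ((Equiv.prodComm ℕ ℕ).hasSum_iff.mpr hsum.hasSum).prod_fiberwise hcol
  have hE := Real.tendsto_euler_sin_prod x
  have hE2 := hE.log hs.ne'
  have hT : Tendsto (fun n : ℕ => Real.log (π * x) - ∑ j ∈ Finset.range n,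
      -Real.log (1 - x ^ 2 / ((j:ℝ) + 1) ^ 2)) atTop (𝓝 (Real.log (Real.sin (π * x)))) := by
    refine hE2.congr fun n => ?_
    have hne : ∀ j ∈ Finset.range n, 1 - x ^ 2 / ((j:ℝ) + 1) ^ 2 ≠ 0 := fun j _ => by
      linarith [hq j]
    rw [Real.log_mul (by positivity) (Finset.prod_ne_zero_iff.mpr hne), Real.log_prod hne]
    simp
  have := tendsto_nhds_unique hT (tendsto_const_nhds.sub hA.tendsto_sum_nat)
  rw [this]
  simpa using hB

lemma real_sum : HasSum (fun k : ℕ => zz k / ((k + 1) * (k + 3)))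
    (-1 / 8 + Real.log (2 * π) / 2 + 3 * (∑' n : ℕ, 1 / (n:ℝ) ^ 3) / (2 * π ^ 2)) := by
  have hlog : IntervalIntegrable (fun x : ℝ => x ^ 3 * Real.log x) volume 0 1 :=
    intervalIntegral.intervalIntegrable_log'.continuousOn_mul (by fun_prop)
  have hls : IntervalIntegrable (fun x : ℝ => x ^ 3 * Real.log (Real.sin (π * x))) volume 0 1 :=
    log_sin_int.continuousOn_mul (by fun_prop)
  have hcst : ∀ c : ℝ, IntervalIntegrable (fun x : ℝ => x ^ 3 * c) volume 0 1 := fun c =>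
    (by fun_prop : Continuous _).intervalIntegrable _ _
  have hL : IntervalIntegrable (fun x : ℝ => x ^ 3 * Real.log π + x ^ 3 * Real.log x
      - x ^ 3 * Real.log (Real.sin (π * x))) volume 0 1 := ((hcst _).add hlog).sub hls
  have hpt : ∀ x : ℝ, 0 < x → x < 1 →
      HasSum (fun k : ℕ => x ^ 3 * (zz k * x ^ (2 * k + 2) / (k + 1)))
        (x ^ 3 * Real.log π + x ^ 3 * Real.log x - x ^ 3 * Real.log (Real.sin (π * x))) := by
    intro x h0 h1
    have := (hasSum_L h0 h1).mul_left (x ^ 3)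
    rw [Real.log_mul Real.pi_ne_zero h0.ne'] at this
    have e : x ^ 3 * Real.log π + x ^ 3 * Real.log x - x ^ 3 * Real.log (Real.sin (π * x)) =
      x ^ 3 * (Real.log π + Real.log x - Real.log (Real.sin (π * x))) := by ring
    rw [e]; exact this
  have hz : ∀ k, 0 ≤ zz k := fun k => tsum_nonneg fun j => by positivity
  have h := intervalIntegral.hasSum_integral_of_dominated_convergence (μ := volume) (a := 0) (b := 1)
    (F := fun (k : ℕ) (x : ℝ) => x ^ 3 * (zz k * x ^ (2 * k + 2) / (k + 1)))
    (f := fun x => x ^ 3 * Real.log π + x ^ 3 * Real.log x - x ^ 3 * Real.log (Real.sin (π * x)))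
    (fun k x => x ^ 3 * (zz k * x ^ (2 * k + 2) / (k + 1))) ?_ ?_ ?_ ?_ ?_
  · have h2 := h.mul_left 2
    have hI : ∫ x in (0:ℝ)..1, x ^ 3 * Real.log (Real.sin (π * x)) =
        - Real.log 2 / 4 - 3 / (4 * π ^ 2) * ∑' n : ℕ, 1 / (n:ℝ) ^ 3 := by
      have e := int_log_sin
      have : ∫ x in (0:ℝ)..1, x ^ 3 * (-(1/2) * Real.log (4 * Real.sin (π * x) ^ 2)) =
          ∫ x in (0:ℝ)..1, (x ^ 3 * (-Real.log 2) - x ^ 3 * Real.log (Real.sin (π * x))) := by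
        refine intervalIntegral.integral_congr_ae ?_
        filter_upwards [ae_lt_one] with x hx hx'
        obtain ⟨hx0, hx1⟩ := hx hx'
        have hs := aux_sin_pos hx0 hx1
        rw [show 4 * Real.sin (π * x) ^ 2 = (2 * Real.sin (π * x)) ^ 2 by ring, Real.log_pow,
          Real.log_mul two_ne_zero hs.ne']
        push_cast; ring
      rw [this, intervalIntegral.integral_sub (hcst _) hls, intervalIntegral.integral_mul_const,
        integral_pow] at e
      norm_num at e ⊢
      linarith
    have hval : -1 / 8 + Real.log (2 * π) / 2 + 3 * (∑' n : ℕ, 1 / (n:ℝ) ^ 3) / (2 * π ^ 2) =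
        2 * ∫ x in (0:ℝ)..1, (x ^ 3 * Real.log π + x ^ 3 * Real.log x
          - x ^ 3 * Real.log (Real.sin (π * x))) := by
      rw [intervalIntegral.integral_sub ((hcst _).add hlog) hls,
        intervalIntegral.integral_add (hcst _) hlog, int_log, hI,
        intervalIntegral.integral_mul_const, integral_pow, Real.log_mul two_ne_zero Real.pi_ne_zero]
      norm_num
      ring
    rw [hval]
    refine (my_hasSum_congr fun k => ?_).mpr h2
    · rw [show (fun x : ℝ => x ^ 3 * (zz k * x ^ (2 * k + 2) / (k + 1))) =
        fun x => (zz k / (k + 1)) * x ^ (2 * k + 5) by ext x; ring]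
      rw [intervalIntegral.integral_const_mul, integral_pow]
      push_cast
      simp
      field_simp
      ring
  · intro n
    exact (by fun_prop : Continuous _).aestronglyMeasurable
  · intro k
    filter_upwards [ae_lt_one] with x hx hx'
    obtain ⟨hx0, hx1⟩ := hx hx'
    have := hz k
    rw [Real.norm_eq_abs, abs_of_nonneg (by positivity)]
  · filter_upwards [ae_lt_one] with x hx hx'
    obtain ⟨hx0, hx1⟩ := hx hx'
    exact (hpt x hx0 hx1).summable
  · refine hL.congr_ae ?_
    rw [EventuallyEq, ae_restrict_iff' measurableSet_uIoc]
    filter_upwards [ae_lt_one] with x hx hx'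
    obtain ⟨hx0, hx1⟩ := hx hx'
    exact (hpt x hx0 hx1).tsum_eq.symm
  · filter_upwards [ae_lt_one] with x hx hx'
    obtain ⟨hx0, hx1⟩ := hx hx'
    exact hpt x hx0 hx1

lemma zeta_zz (k : ℕ) : riemannZeta (2 * ((k : ℂ) + 1)) = (zz k : ℂ) := by
  have h := zeta_nat_eq_tsum_of_gt_one (k := 2 * k + 2) (by omega)
  have hs : Summable (fun n : ℕ => 1 / (n : ℝ) ^ (2 * k + 2)) :=
    Real.summable_one_div_nat_pow.mpr (by omega)
  have e : zz k = ∑' n : ℕ, 1 / (n : ℝ) ^ (2 * k + 2) := by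
    rw [hs.tsum_eq_zero_add]
    simp [zz]
  rw [show (2 * ((k : ℂ) + 1)) = ((2 * k + 2 : ℕ) : ℂ) by push_cast; ring, h, e, Complex.ofReal_tsum]
  push_cast
  rfl

theorem stmt7 :
    ∑' k : ℕ, riemannZeta (2 * ((k : ℂ) + 1)) / (((k : ℂ) + 1) * ((k : ℂ) + 3))
      = -1 / 8 + Real.log (2 * π) / 2 + 3 * riemannZeta 3 / (2 * (π : ℂ) ^ 2) := by
  have h3 := zeta_nat_eq_tsum_of_gt_one (k := 3) (by norm_num)
  have h := congrArg (fun x : ℝ => (x : ℂ)) real_sum.tsum_eq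
  simp only [Complex.ofReal_tsum] at h
  push_cast at h h3
  rw [h3, ← h]
  refine tsum_congr fun k => ?_
  rw [zeta_zz]
end

section
/- ∑_{k=1}^∞ ζ(2k)/(4^k k(k+1)) = −1/2 + ln(π) − 7ζ(3)/(2π²). -/
open Real Complex

namespace Aux
open Filter Topology MeasureTheory

lemma hasSum_prod {f : ℕ × ℕ → ℝ} {g : ℕ → ℝ} {a : ℝ} (hs : Summable f)
    (hf : ∀ n, HasSum (fun k => f (n, k)) (g n)) (hg : HasSum g a) : HasSum f a := by
  have h := hs.hasSum.prod_fiberwise hf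
  rw [← h.unique hg]
  exact hs.hasSum

noncomputable def t (p : ℕ × ℕ) : ℝ := ((1 / 4) / ((p.1 : ℝ) + 1) ^ 2) ^ (p.2 + 1)

lemma t_nonneg (p) : 0 ≤ t p := by unfold t; positivity

lemma summable_sq : Summable (fun n : ℕ => 1 / ((n : ℝ) + 1) ^ 2) := by
  have := (summable_nat_add_iff 1).2 (Real.summable_one_div_nat_pow (p := 2).2 (by norm_num))
  simpa using this

lemma summable_t : Summable t := by
  have h1 : Summable (fun k : ℕ => (1 / 4 : ℝ) ^ (k + 1)) :=
    (summable_nat_add_iff 1).2 (summable_geometric_of_lt_one (by norm_num) (by norm_num))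
  have h2 := summable_sq.mul_of_nonneg h1 (fun _ => by positivity) (fun _ => by positivity)
  refine Summable.of_nonneg_of_le t_nonneg ?_ h2
  rintro ⟨n, k⟩
  simp only [t]
  rw [div_eq_mul_one_div, mul_pow, mul_comm]
  gcongr
  rw [pow_succ]
  have h3 : 1 / ((n : ℝ) + 1) ^ 2 ≤ 1 := by
    rw [div_le_one (by positivity)]
    nlinarith [(Nat.cast_nonneg n : (0 : ℝ) ≤ n)]
  have h4 : (1 / ((n : ℝ) + 1) ^ 2) ^ k ≤ 1 := pow_le_one₀ (by positivity) h3
  have h5 : 0 ≤ 1 / ((n : ℝ) + 1) ^ 2 := by positivity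
  nlinarith

lemma y_lt (n : ℕ) : (1 / 4) / ((n : ℝ) + 1) ^ 2 < 1 := by
  rw [div_lt_one (by positivity)]
  nlinarith [(Nat.cast_nonneg n : (0 : ℝ) ≤ n)]

lemma partA : HasSum (fun p => t p / ((p.2 : ℝ) + 1)) (Real.log (π / 2)) := by
  have hs : Summable (fun p => t p / ((p.2 : ℝ) + 1)) := by
    refine Summable.of_nonneg_of_le (fun p => div_nonneg (t_nonneg p) (by positivity)) (fun p => ?_)
      summable_t
    exact div_le_self (t_nonneg p) (by linarith [(Nat.cast_nonneg p.2 : (0 : ℝ) ≤ p.2)])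
  have hf : ∀ n : ℕ, HasSum (fun k : ℕ => t (n, k) / ((k : ℝ) + 1))
      (-Real.log (1 - (1 / 4) / ((n : ℝ) + 1) ^ 2)) := fun n => by
    have h0 : 0 ≤ (1 / 4) / ((n : ℝ) + 1) ^ 2 := by positivity
    have h1 : |(1 / 4) / ((n : ℝ) + 1) ^ 2| < 1 := by
      rw [abs_of_nonneg h0]
      exact y_lt n
    have h2 := Real.hasSum_pow_div_log_of_abs_lt_one h1
    simp only [t]
    exact h2
  refine hasSum_prod hs hf ?_
  rw [hasSum_iff_tendsto_nat_of_nonneg]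
  · have h := Real.tendsto_euler_sin_prod (1 / 2)
    rw [show π * (1 / 2) = π / 2 by ring, Real.sin_pi_div_two] at h
    have h2 := ((Real.continuousAt_log one_ne_zero).tendsto.comp h).const_sub (Real.log (π / 2))
    simp only [Real.log_one, sub_zero] at h2
    refine h2.congr fun N => ?_
    have hp : ∀ j : ℕ, (1 : ℝ) - (1 / 2) ^ 2 / ((j : ℝ) + 1) ^ 2 ≠ 0 := fun j => by
      have := y_lt j
      norm_num at this ⊢
      intro h; linarith
    simp only [Function.comp]
    rw [Real.log_mul (by positivity) (Finset.prod_ne_zero_iff.2 fun j _ => hp j),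
      Real.log_prod (fun j _ => hp j), Finset.sum_neg_distrib]
    norm_num
  · intro n
    have := y_lt n
    have h0 : 0 ≤ (1 / 4) / ((n : ℝ) + 1) ^ 2 := by positivity
    have := Real.log_nonpos (x := 1 - (1 / 4) / ((n : ℝ) + 1) ^ 2) (by linarith) (by linarith)
    linarith

noncomputable def g (x : ℝ) : ℝ := x ^ 2 / Real.sin (π * x)

lemma sin_ge {x : ℝ} (h0 : 0 < x) (h1 : x ≤ 1 / 2) : 2 * x ≤ Real.sin (π * x) := by
  have := Real.mul_le_sin (x := π * x) (by positivity) (by nlinarith [Real.pi_pos])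
  have e : 2 / π * (π * x) = 2 * x := by field_simp
  linarith

lemma g_int : IntervalIntegrable g volume 0 (1 / 2) := by
  have hc : IntervalIntegrable (fun _ : ℝ => (1 : ℝ)) volume 0 (1 / 2) :=
    continuous_const.intervalIntegrable _ _
  refine hc.mono_fun (Measurable.aestronglyMeasurable ?_) ?_
  · unfold g; fun_prop
  · rw [Set.uIoc_of_le (by norm_num)]
    refine (ae_restrict_iff' measurableSet_Ioc).2 (ae_of_all _ fun x hx => ?_)
    have := sin_ge hx.1 hx.2
    have hx0 := hx.1
    have hx1 := hx.2
    have hs : 0 < Real.sin (π * x) := by linarith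
    simp only [g]
    rw [Real.norm_of_nonneg (by positivity), norm_one, div_le_one hs]
    nlinarith

noncomputable def I0 : ℝ := ∫ x in (0 : ℝ)..(1 / 2), g x * Real.cos (π * x)

lemma gcos_int (a : ℝ) : IntervalIntegrable (fun x => g x * Real.cos (a * x)) volume 0 (1 / 2) :=
  g_int.mul_continuousOn (by fun_prop)

lemma ptB {x : ℝ} (h0 : 0 < x) (h1 : x ≤ 1 / 2) :
    HasSum (fun p : ℕ × ℕ => 8 * x * (x ^ 2 / ((p.1 : ℝ) + 1) ^ 2) ^ (p.2 + 1))
      (4 * x - 4 * π * (g x * Real.cos (π * x))) := by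
  have hs : Summable (fun p : ℕ × ℕ => 8 * x * (x ^ 2 / ((p.1 : ℝ) + 1) ^ 2) ^ (p.2 + 1)) := by
    apply Summable.mul_left
    refine Summable.of_nonneg_of_le (fun p => by positivity) (fun p => ?_) summable_t
    unfold t
    gcongr
    nlinarith
  have hlt : ∀ n : ℕ, x ^ 2 / ((n : ℝ) + 1) ^ 2 < 1 := fun n => by
    refine lt_of_le_of_lt ?_ (y_lt n)
    gcongr
    nlinarith
  have hf : ∀ n : ℕ, HasSum (fun k : ℕ => 8 * x * (x ^ 2 / ((n : ℝ) + 1) ^ 2) ^ (k + 1))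
      (8 * x * ((x ^ 2 / ((n : ℝ) + 1) ^ 2) * (1 - x ^ 2 / ((n : ℝ) + 1) ^ 2)⁻¹)) := fun n => by
    have := (hasSum_geometric_of_lt_one (by positivity) (hlt n)).mul_left
      (x ^ 2 / ((n : ℝ) + 1) ^ 2)
    have := this.mul_left (8 * x)
    simpa only [pow_succ'] using this
  refine hasSum_prod hs hf ?_
  have hz : (x : ℂ) ∈ Complex.integerComplement := by
    rw [Complex.mem_integerComplement_iff]
    rintro ⟨n, hn⟩
    have hn' : (n : ℝ) = x := by exact_mod_cast hn
    rw [← hn'] at h0 h1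
    have : 0 < n := by exact_mod_cast h0
    have : (1 : ℝ) ≤ n := by exact_mod_cast this
    linarith
  have hc := (summable_cotTerm hz).hasSum
  have he : ∑' n : ℕ, cotTerm (x : ℂ) n = _ := (cot_series_rep' hz).symm
  rw [he] at hc
  have hc2 := hc.mul_left (-4 * (x : ℂ) ^ 2)
  rw [← Complex.hasSum_ofReal]
  have hsin : Real.sin (π * x) ≠ 0 := by linarith [sin_ge h0 h1]
  have hsin' : Complex.sin (π * x) ≠ 0 := by exact_mod_cast hsin
  have hx : (x : ℂ) ≠ 0 := by exact_mod_cast h0.ne'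
  convert! hc2 using 1
  · funext n
    rw [cotTerm_identity hz]
    have e1 : (1 : ℂ) - x ^ 2 / ((n : ℂ) + 1) ^ 2 ≠ 0 := by
      have := hlt n
      have : 1 - x ^ 2 / ((n : ℝ) + 1) ^ 2 ≠ 0 := by linarith
      exact_mod_cast this
    have e2 : (n : ℂ) + 1 ≠ 0 := by exact_mod_cast n.succ_ne_zero
    have e3 : ((n : ℂ) + 1) ^ 2 - x ^ 2 ≠ 0 := by
      intro h; apply e1; field_simp; simpa using h
    have e4 : ((x : ℂ) + (n + 1)) * (x - (n + 1)) ≠ 0 := by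
      intro h; apply e3; linear_combination -h
    have e5 : ((x : ℂ) + (n + 1)) * (x - (n + 1)) = -(((n : ℂ) + 1) ^ 2 - x ^ 2) := by ring
    push_cast
    rw [e5, show (1 : ℂ) - x ^ 2 / ((n : ℂ) + 1) ^ 2 = (((n : ℂ) + 1) ^ 2 - x ^ 2) / ((n : ℂ) + 1) ^ 2 by
      field_simp]
    field_simp
    ring
  · unfold g
    push_cast
    rw [Complex.cot]
    field_simp
    ring

lemma partB : HasSum (fun p => t p / ((p.2 : ℝ) + 2)) (1 / 2 - 4 * π * I0) := by
  have h := intervalIntegral.hasSum_integral_of_dominated_convergence (μ := volume) (a := 0)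
    (b := 1 / 2) (F := fun (p : ℕ × ℕ) (x : ℝ) => 8 * x * (x ^ 2 / ((p.1 : ℝ) + 1) ^ 2) ^ (p.2 + 1))
    (f := fun x => 4 * x - 4 * π * (g x * Real.cos (π * x))) (fun p _ => 8 * t p)
    (fun p => (Continuous.aestronglyMeasurable (by fun_prop)))
    (fun p => ae_of_all _ fun x hx => ?_) (ae_of_all _ fun x _ => summable_t.mul_left 8)
    (continuous_const.intervalIntegrable _ _) (ae_of_all _ fun x hx => ?_)
  · convert! h using 1
    · funext p
      simp only [div_pow, ← pow_mul, t]
      have : ∀ x : ℝ, 8 * x * (x ^ (2 * (p.2 + 1)) / ((p.1 : ℝ) + 1) ^ (2 * (p.2 + 1)))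
          = 8 / ((p.1 : ℝ) + 1) ^ (2 * (p.2 + 1)) * x ^ (2 * p.2 + 3) := fun x => by ring
      simp only [this]
      rw [intervalIntegral.integral_const_mul, integral_pow]
      have h4 : (4 : ℝ) ^ (p.2 + 1) * 4 = 2 ^ (2 * p.2 + 3 + 1) := by
        rw [show (4 : ℝ) = 2 ^ 2 by norm_num, ← pow_mul, ← pow_add]; ring_nf
      rw [one_div_pow, one_pow, ← h4, zero_pow (by omega)]
      push_cast
      field_simp
      ring
    · rw [intervalIntegral.integral_sub, intervalIntegral.integral_const_mul,
        intervalIntegral.integral_const_mul, I0]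
      · simp; norm_num
      · exact Continuous.intervalIntegrable (by fun_prop) _ _
      · exact (gcos_int π).const_mul _
  · rw [Set.uIoc_of_le (by norm_num)] at hx
    have hx0 := hx.1
    have hx1 := hx.2
    have h0 : 0 ≤ 8 * x * (x ^ 2 / ((p.1 : ℝ) + 1) ^ 2) ^ (p.2 + 1) := by positivity
    rw [Real.norm_of_nonneg h0, t]
    gcongr
    · linarith
    · nlinarith
  · rw [Set.uIoc_of_le (by norm_num)] at hx
    exact ptB hx.1 hx.2

lemma dirichlet {x : ℝ} (hx : Real.sin (π * x) ≠ 0) (N : ℕ) :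
    g x * Real.cos (π * x) = 2 * ∑ n ∈ Finset.range N, x ^ 2 * Real.sin (2 * π * (n + 1) * x)
      + g x * Real.cos ((2 * N + 1) * π * x) := by
  induction N with
  | zero => simp
  | succ N ih =>
    rw [ih, Finset.sum_range_succ]
    have : Real.cos ((2 * N + 1) * π * x) = Real.cos ((2 * (N + 1 : ℕ) + 1) * π * x)
        + 2 * Real.sin (2 * π * (N + 1) * x) * Real.sin (π * x) := by
      have e1 : (2 * (N : ℝ) + 1) * π * x = 2 * π * (N + 1) * x - π * x := by ring
      have e2 : (2 * ((N + 1 : ℕ) : ℝ) + 1) * π * x = 2 * π * (N + 1) * x + π * x := by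
        push_cast; ring
      rw [e1, e2, Real.cos_sub, Real.cos_add]; ring
    rw [this]
    have hg : g x * Real.sin (π * x) = x ^ 2 := by
      unfold g; exact div_mul_cancel₀ _ hx
    linear_combination 2 * Real.sin (2 * π * (N + 1) * x) * hg

lemma s_int (n : ℕ) : ∫ x in (0 : ℝ)..(1 / 2), x ^ 2 * Real.sin (2 * π * (n + 1) * x)
    = (-1) ^ n / (8 * π * (n + 1)) - (1 + (-1) ^ n) / (4 * π ^ 3 * (n + 1) ^ 3) := by
  set b : ℝ := 2 * π * (n + 1) with hb
  have hb0 : b ≠ 0 := by positivity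
  have hd : ∀ x ∈ Set.uIcc (0 : ℝ) (1 / 2), HasDerivAt (fun x : ℝ => -x ^ 2 * Real.cos (b * x) / b
      + 2 * x * Real.sin (b * x) / b ^ 2 + 2 * Real.cos (b * x) / b ^ 3)
      (x ^ 2 * Real.sin (b * x)) x := fun x _ => by
    have h1 : HasDerivAt (fun x : ℝ => b * x) b x := by
      simpa using (hasDerivAt_id x).const_mul b
    have hc := h1.cos
    have hs := h1.sin
    have hx2 : HasDerivAt (fun x : ℝ => -x ^ 2) (-(2 * x)) x := by
      convert! (hasDerivAt_pow 2 x).neg using 1; simp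
    have hx1 : HasDerivAt (fun x : ℝ => 2 * x) 2 x := by
      simpa using (hasDerivAt_id x).const_mul 2
    convert! (((hx2.mul hc).div_const b).add ((hx1.mul hs).div_const (b ^ 2))).add
      ((hc.const_mul 2).div_const (b ^ 3)) using 1
    field_simp
    ring
  rw [intervalIntegral.integral_eq_sub_of_hasDerivAt hd
    (Continuous.intervalIntegrable (by fun_prop) _ _)]
  have e : b * (1 / 2) = ((n + 1 : ℕ) : ℝ) * π := by rw [hb]; push_cast; ring
  rw [e, Real.sin_nat_mul_pi, Real.cos_nat_mul_pi]
  simp only [mul_zero, Real.cos_zero, Real.sin_zero]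
  rw [hb, pow_succ]
  field_simp
  ring

lemma sumS (M : ℕ) : ∑ n ∈ Finset.range (2 * M), (((-1 : ℝ)) ^ n / (8 * π * (n + 1))
      - (1 + (-1) ^ n) / (4 * π ^ 3 * (n + 1) ^ 3))
    = ((harmonic (2 * M) : ℝ) - harmonic M) / (8 * π)
      - (1 / (2 * π ^ 3)) * ∑ m ∈ Finset.range M, 1 / (2 * (m : ℝ) + 1) ^ 3 := by
  induction M with
  | zero => simp
  | succ M ih =>
    rw [show 2 * (M + 1) = 2 * M + 1 + 1 by ring, Finset.sum_range_succ, Finset.sum_range_succ, ih,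
      Finset.sum_range_succ, harmonic_succ, harmonic_succ, harmonic_succ]
    have hp : ((-1 : ℝ)) ^ (2 * M) = 1 := by rw [pow_mul]; simp
    have hp2 : ((-1 : ℝ)) ^ (2 * M + 1) = -1 := by rw [pow_succ, hp]; simp
    simp only [hp2, hp]
    push_cast
    rw [show (2 * (M : ℝ) + 1 + 1) = 2 * (M + 1) by ring]
    field_simp
    ring

lemma tendsto_harm : Tendsto (fun M : ℕ => (harmonic (2 * M) : ℝ) - harmonic M) atTop
    (𝓝 (Real.log 2)) := by
  have h1 := Real.tendsto_harmonic_sub_log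
  have h2 := h1.comp (tendsto_id.const_mul_atTop' (r := 2) (by norm_num) : Tendsto (fun M : ℕ => 2 * M) atTop atTop)
  have h3 := (h2.sub h1).const_add (Real.log 2)
  simp only [sub_self, add_zero] at h3
  refine h3.congr' ?_
  filter_upwards [eventually_ne_atTop 0] with M hM
  have : (M : ℝ) ≠ 0 := by exact_mod_cast hM
  simp only [Function.comp]
  push_cast
  rw [Real.log_mul two_ne_zero this]
  ring

noncomputable def z3 : ℝ := ∑' n : ℕ, 1 / ((n : ℝ) + 1) ^ 3

lemma summable_z3 : Summable (fun n : ℕ => 1 / ((n : ℝ) + 1) ^ 3) := by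
  have := (summable_nat_add_iff 1).2 (Real.summable_one_div_nat_pow (p := 3).2 (by norm_num))
  simpa using this

lemma odd_sum : HasSum (fun m : ℕ => 1 / (2 * (m : ℝ) + 1) ^ 3) (7 / 8 * z3) := by
  have hs : Summable (fun m : ℕ => 1 / (2 * (m : ℝ) + 1) ^ 3) := by
    have := summable_z3.comp_injective (i := fun m : ℕ => 2 * m) (fun a b h => by simpa using h)
    simpa [Function.comp_def] using this
  have ho : HasSum (fun m : ℕ => 1 / (((2 * m + 1 : ℕ) : ℝ) + 1) ^ 3) (1 / 8 * z3) := by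
    have := summable_z3.hasSum.mul_left (1 / 8)
    refine this.congr_fun ?_ |> fun h => h
    intro m
    push_cast
    field_simp
    ring
  have he : HasSum (fun m : ℕ => 1 / (((2 * m : ℕ) : ℝ) + 1) ^ 3)
    (∑' m : ℕ, 1 / (2 * (m : ℝ) + 1) ^ 3) := by simpa using hs.hasSum
  have := (HasSum.even_add_odd (f := fun n : ℕ => 1 / ((n : ℝ) + 1) ^ 3) he ho).unique
    summable_z3.hasSum
  have h2 := hs.hasSum
  have e : ∑' m : ℕ, 1 / (2 * (m : ℝ) + 1) ^ 3 = 7 / 8 * z3 := by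
    change _ = z3 at this
    linarith
  rwa [e] at h2

lemma rl : Tendsto (fun M : ℕ => ∫ x in (0 : ℝ)..(1 / 2),
    g x * Real.cos ((2 * (2 * M : ℕ) + 1) * π * x)) atTop (𝓝 0) := by
  have h := Real.tendsto_integral_exp_smul_cocompact
    (fun x : ℝ => (((Set.Ioc (0 : ℝ) (1 / 2)).indicator g x : ℝ) : ℂ))
  have hw : Tendsto (fun M : ℕ => (4 * (M : ℝ) + 1) / 2) atTop (cocompact ℝ) := by
    refine Tendsto.mono_right ?_ atTop_le_cocompact
    refine tendsto_atTop_mono (f := fun M : ℕ => (M : ℝ)) (fun M => ?_) tendsto_natCast_atTop_atTop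
    have : (0 : ℝ) ≤ M := Nat.cast_nonneg M
    linarith
  have h2 := (Complex.continuous_re.tendsto _).comp (h.comp hw)
  simp only [Complex.zero_re] at h2
  refine h2.congr fun M => ?_
  simp only [Function.comp]
  have hgi : Integrable (fun x : ℝ => (((Set.Ioc (0 : ℝ) (1 / 2)).indicator g x : ℝ) : ℂ)) := by
    have := (integrable_indicator_iff (f := g) (μ := volume)
      (measurableSet_Ioc (a := (0 : ℝ)) (b := 1 / 2))).2 <| (intervalIntegrable_iff_integrableOn_Ioc_of_le (by norm_num)).1 g_int
    exact this.ofReal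
  have hi : Integrable (fun v : ℝ => Real.fourierChar (-(v * ((4 * (M : ℝ) + 1) / 2))) •
      (((Set.Ioc (0 : ℝ) (1 / 2)).indicator g v : ℝ) : ℂ)) := by
    have := (Real.fourierIntegral_convergent_iff (μ := volume) (f := fun x : ℝ => (((Set.Ioc (0 : ℝ) (1 / 2)).indicator g x : ℝ) : ℂ)) ((4 * (M : ℝ) + 1) / 2)).2 hgi
    simpa [mul_comm] using this
  have h3 := integral_re hi
  simp only [RCLike.re_eq_complex_re] at h3
  rw [← h3, intervalIntegral.integral_of_le (by norm_num), ← integral_indicator measurableSet_Ioc]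
  congr 1
  funext v
  by_cases hv : v ∈ Set.Ioc (0 : ℝ) (1 / 2)
  · simp only [Set.indicator_of_mem hv, Circle.smul_def, Real.fourierChar_apply, smul_eq_mul, Complex.re_mul_ofReal]
    rw [Complex.exp_ofReal_mul_I_re, mul_comm, ← Real.cos_neg]
    congr 2
    push_cast
    ring
  · simp only [Set.indicator_of_notMem hv]
    simp

lemma partC : 4 * π * I0 = Real.log 2 - 7 * z3 / (2 * π ^ 2) := by
  have h1 : ∀ M : ℕ, I0 = 2 * (((harmonic (2 * M) : ℝ) - harmonic M) / (8 * π)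
      - (1 / (2 * π ^ 3)) * ∑ m ∈ Finset.range M, 1 / (2 * (m : ℝ) + 1) ^ 3)
      + ∫ x in (0 : ℝ)..(1 / 2), g x * Real.cos ((2 * (2 * M : ℕ) + 1) * π * x) := fun M => by
    rw [← sumS]
    simp only [← s_int]
    rw [← intervalIntegral.integral_finsetSum, ← intervalIntegral.integral_const_mul,
      ← intervalIntegral.integral_add, I0]
    · refine intervalIntegral.integral_congr_ae (ae_of_all _ fun x hx => ?_)
      rw [Set.uIoc_of_le (by norm_num)] at hx
      exact dirichlet (by linarith [sin_ge hx.1 hx.2, hx.1]) _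
    · exact Continuous.intervalIntegrable (by fun_prop) _ _
    · exact gcos_int _
    · intro i _
      exact Continuous.intervalIntegrable (by fun_prop) _ _
  have h2 := (((tendsto_harm.div_const (8 * π)).sub
    (odd_sum.tendsto_sum_nat.const_mul (1 / (2 * π ^ 3)))).const_mul 2).add rl
  have h3 := tendsto_nhds_unique (tendsto_const_nhds.congr h1) h2
  rw [h3]
  field_simp
  ring

lemma zeta3 : riemannZeta 3 = (z3 : ℂ) := by
  have := zeta_eq_tsum_one_div_nat_add_one_cpow (s := 3) (by norm_num)
  rw [this, z3, Complex.ofReal_tsum]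
  congr 1; funext n
  push_cast
  norm_cast

lemma zeta_even (k : ℕ) : HasSum (fun n : ℕ => ((1 / ((n : ℝ) + 1) ^ (2 * (k + 1)) : ℝ) : ℂ))
    (riemannZeta (2 * ((k : ℂ) + 1))) := by
  have := zeta_eq_tsum_one_div_nat_add_one_cpow (s := 2 * ((k : ℂ) + 1))
    (by simp; have : (0 : ℝ) ≤ k := Nat.cast_nonneg k
        linarith)
  rw [this]
  have hs : Summable (fun n : ℕ => (1 / ((n : ℝ) + 1) ^ (2 * (k + 1)) : ℝ)) := by
    have := (summable_nat_add_iff 1).2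
      (Real.summable_one_div_nat_pow (p := 2 * (k + 1)).2 (by omega))
    simpa using this
  have h2 := Complex.hasSum_ofReal.2 hs.hasSum
  convert h2 using 1
  rw [Complex.ofReal_tsum]
  congr 1; funext n
  rw [show (2 : ℂ) * ((k : ℂ) + 1) = ((2 * (k + 1) : ℕ) : ℂ) by push_cast; ring, Complex.cpow_natCast]
  push_cast
  rfl

end Aux

theorem stmt10 :
    ∑' k : ℕ, riemannZeta (2 * ((k : ℂ) + 1))
        / ((4 : ℂ) ^ (k + 1) * ((k : ℂ) + 1) * ((k : ℂ) + 2))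
      = -1 / 2 + Real.log π - 7 * riemannZeta 3 / (2 * (π : ℂ) ^ 2) := by
  have h := (Complex.hasSum_ofReal.2 (Aux.partA.sub Aux.partB))
  have h2 := (Equiv.prodComm ℕ ℕ).hasSum_iff.2 h
  have h3 := h2.prod_fiberwise (g := fun k : ℕ => riemannZeta (2 * ((k : ℂ) + 1))
        / ((4 : ℂ) ^ (k + 1) * ((k : ℂ) + 1) * ((k : ℂ) + 2))) (fun k => by
    have hk := (Aux.zeta_even k).div_const ((4 : ℂ) ^ (k + 1) * ((k : ℂ) + 1) * ((k : ℂ) + 2))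
    convert! hk using 1
    funext n
    have e1 : (k : ℂ) + 1 ≠ 0 := by exact_mod_cast k.succ_ne_zero
    have e2 : (k : ℂ) + 2 ≠ 0 := by exact_mod_cast (k + 1).succ_ne_zero
    have e3 : (n : ℂ) + 1 ≠ 0 := by exact_mod_cast n.succ_ne_zero
    simp only [Function.comp, Equiv.prodComm_apply, Prod.swap, Aux.t]
    push_cast
    rw [div_pow, ← pow_mul, div_pow, one_pow]
    field_simp
    ring)
  rw [h3.tsum_eq, Aux.partC, Aux.zeta3, Real.log_div Real.pi_ne_zero two_ne_zero]
  push_cast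
  ring
end

section
/- For every real z with 0 < |z| < 1, ∑_{k=1}^∞ ζ(2k) z^{2k} / (2k+1) = 1/2 − (1/2)·ln(2 sin(πz)) − Cl₂(2πz)/(4πz), where Cl₂(x) = ∑_{k=1}^∞ sin(kx)/k² is the Clausen function of order 2. -/
open Real Complex

/-- The Clausen function of order 2, `Cl₂(x) = ∑_{k≥1} sin(kx)/k²`. -/
noncomputable def Cl2 (x : ℝ) : ℝ := ∑' k : ℕ, Real.sin (((k : ℝ) + 1) * x) / ((k : ℝ) + 1) ^ 2


noncomputable def evenZ (k : ℕ) : ℝ := ∑' n : ℕ, 1 / ((n : ℝ) + 1) ^ (2 * (k + 1))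

lemma evenZ_summable (k : ℕ) : Summable fun n : ℕ => 1 / ((n : ℝ) + 1) ^ (2 * (k + 1)) := by
  have h := (summable_nat_add_iff 1).2 (Real.summable_one_div_nat_pow (p := 2 * (k + 1)) |>.2 (by omega))
  simpa using h

lemma evenZ_eq (k : ℕ) : riemannZeta (2 * ((k : ℂ) + 1)) = (evenZ k : ℂ) := by
  have h := zeta_nat_eq_tsum_of_gt_one (k := 2 * (k + 1)) (by omega)
  push_cast at h
  rw [h, evenZ, Complex.ofReal_tsum, Summable.tsum_eq_zero_add]
  · push_cast
    simp
  · have := (Complex.summable_one_div_nat_cpow (p := ((2 * (k + 1) : ℕ) : ℂ))).2 (by norm_cast; omega)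
    simpa only [Complex.cpow_natCast] using this

lemma evenZ_nonneg (k : ℕ) : 0 ≤ evenZ k := tsum_nonneg fun n => by positivity

lemma evenZ_le (k : ℕ) : evenZ k ≤ evenZ 0 := by
  refine Summable.tsum_le_tsum (fun n => ?_) (evenZ_summable k) (evenZ_summable 0)
  apply one_div_le_one_div_of_le (by positivity)
  exact pow_le_pow_right₀ (by linarith [Nat.cast_nonneg (α := ℝ) n]) (by omega)

lemma mem_IC {x : ℝ} (h0 : 0 < x) (h1 : x < 1) : (x : ℂ) ∈ Complex.integerComplement := by
  rintro ⟨m, hm⟩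
  have hm : (m : ℝ) = x := by exact_mod_cast hm
  have a : 0 < m := by rw [← hm] at h0; exact_mod_cast h0
  have b : m < 1 := by rw [← hm] at h1; exact_mod_cast h1
  omega

lemma cot_real {x : ℝ} (h0 : 0 < x) (h1 : x < 1) :
    HasSum (fun n : ℕ => 1 / (x - ((n : ℝ) + 1)) + 1 / (x + ((n : ℝ) + 1)))
      (π * (Real.cos (π * x) / Real.sin (π * x)) - 1 / x) := by
  have hs : Summable fun n : ℕ => cotTerm (x : ℂ) n := summable_cotTerm (mem_IC h0 h1)
  have h := hs.hasSum
  have e := cot_series_rep' (mem_IC h0 h1)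
  have h2 : ∑' n, cotTerm (x : ℂ) n = ((π * (Real.cos (π * x) / Real.sin (π * x)) - 1 / x : ℝ) : ℂ) := by
    simp only [cotTerm]
    rw [← e, Complex.cot_eq_cos_div_sin]
    push_cast
    rfl
  rw [h2] at h
  rw [← Complex.hasSum_ofReal]
  convert h using 2 with n
  simp [cotTerm]

lemma evenZ_gen {x : ℝ} (h0 : 0 < x) (h1 : x < 1) :
    ∑' k, evenZ k * x ^ (2 * (k + 1)) = 1 / 2 - π * x * (Real.cos (π * x) / Real.sin (π * x)) / 2 := by
  have hk : ∀ n : ℕ, HasSum (fun k : ℕ => (x / ((n : ℝ) + 1)) ^ (2 * (k + 1)))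
      (-(x / 2) * (1 / (x - ((n : ℝ) + 1)) + 1 / (x + ((n : ℝ) + 1)))) := by
    intro n
    have hn : (0 : ℝ) ≤ n := Nat.cast_nonneg n
    have hq0 : 0 ≤ x / ((n : ℝ) + 1) := by positivity
    have hq1 : x / ((n : ℝ) + 1) < 1 := by rw [div_lt_one (by positivity)]; linarith
    have hq : (x / ((n : ℝ) + 1)) ^ 2 < 1 := by nlinarith
    have := (hasSum_geometric_of_lt_one (by positivity) hq).mul_left ((x / ((n : ℝ) + 1)) ^ 2)
    have he : (fun k : ℕ => (x / ((n : ℝ) + 1)) ^ (2 * (k + 1))) =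
        fun i : ℕ => (x / ((n : ℝ) + 1)) ^ 2 * ((x / ((n : ℝ) + 1)) ^ 2) ^ i := by
      funext k; rw [pow_mul, pow_succ]; ring
    rw [he]
    have a : x - ((n : ℝ) + 1) ≠ 0 := by linarith
    have b : x + ((n : ℝ) + 1) ≠ 0 := by positivity
    have c : (n : ℝ) + 1 ≠ 0 := by positivity
    have d' : ((n : ℝ) + 1) ^ 2 - x ^ 2 ≠ 0 := by nlinarith
    have e1 : 1 / (x - ((n : ℝ) + 1)) + 1 / (x + ((n : ℝ) + 1)) =
        -(2 * x) / (((n : ℝ) + 1) ^ 2 - x ^ 2) := by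
      rw [div_add_div _ _ a b, div_eq_div_iff (mul_ne_zero a b) d']
      ring
    have e2 : 1 - (x / ((n : ℝ) + 1)) ^ 2 = (((n : ℝ) + 1) ^ 2 - x ^ 2) / ((n : ℝ) + 1) ^ 2 := by
      field_simp
    have e3 : -(x / 2) * (1 / (x - ((n : ℝ) + 1)) + 1 / (x + ((n : ℝ) + 1))) =
        (x / ((n : ℝ) + 1)) ^ 2 * (1 - (x / ((n : ℝ) + 1)) ^ 2)⁻¹ := by
      rw [e1, e2, inv_div]
      field_simp
    rw [e3]
    exact this
  have hn := (cot_real h0 h1).mul_left (-(x / 2))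
  have hS : Summable (Function.uncurry fun (n k : ℕ) => (x / ((n : ℝ) + 1)) ^ (2 * (k + 1))) := by
    rw [summable_prod_of_nonneg (fun p => by simp only [Function.uncurry]; positivity)]
    refine ⟨fun n => (hk n).summable, ?_⟩
    simp only [Function.uncurry]
    simp_rw [fun n => (hk n).tsum_eq]
    exact hn.summable
  have hc := hS.tsum_comm
  simp_rw [fun n => (hk n).tsum_eq] at hc
  rw [hn.tsum_eq] at hc
  have : ∀ k, evenZ k * x ^ (2 * (k + 1)) = ∑' n : ℕ, (x / ((n : ℝ) + 1)) ^ (2 * (k + 1)) := by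
    intro k
    rw [evenZ, ← tsum_mul_right]
    congr 1; ext n; rw [div_pow]; ring
  simp_rw [this]
  rw [hc]
  field_simp
  ring

noncomputable def oddS (x : ℝ) : ℝ := ∑' k, evenZ k * x ^ (2 * (k + 1) + 1) / (2 * ((k : ℝ) + 1) + 1)

lemma oddS_deriv {x : ℝ} (hx : |x| < 1) : HasDerivAt oddS (∑' k, evenZ k * x ^ (2 * (k + 1))) x := by
  obtain ⟨r, hr, hr1⟩ := exists_between hx
  have hr0 : 0 ≤ r := (abs_nonneg x).trans hr.le
  refine hasDerivAt_tsum_of_isPreconnected (u := fun k => evenZ 0 * r ^ (2 * (k + 1)))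
    (t := Metric.ball 0 r) (y₀ := 0) (g := fun k x => evenZ k * x ^ (2 * (k + 1) + 1) / (2 * ((k : ℝ) + 1) + 1))
    (g' := fun k x => evenZ k * x ^ (2 * (k + 1))) ?_ Metric.isOpen_ball (convex_ball 0 r).isPreconnected
    ?_ ?_ (by simpa using lt_of_le_of_lt (abs_nonneg x) hr) ?_ (by simpa using hr)
  · have := (summable_geometric_of_lt_one (r := r ^ 2) (by positivity) (by nlinarith)).mul_left (evenZ 0 * r ^ 2)
    refine this.congr fun k => ?_
    rw [pow_mul, pow_succ (r ^ 2)]; ring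
  · intro k y _
    have := ((hasDerivAt_pow (2 * (k + 1) + 1) y).const_mul (evenZ k)).div_const (2 * ((k : ℝ) + 1) + 1)
    refine this.congr_deriv ?_
    have c : 2 * ((k : ℝ) + 1) + 1 ≠ 0 := by positivity
    push_cast
    field_simp
  · intro k y hy
    have hy : |y| < r := by simpa using hy
    rw [norm_mul, norm_pow, Real.norm_eq_abs, Real.norm_eq_abs, abs_of_nonneg (evenZ_nonneg k)]
    gcongr
    · exact evenZ_nonneg 0
    · exact evenZ_le k
  · simp [summable_zero]

lemma sq_summable : Summable fun n : ℕ => 1 / ((n : ℝ) + 1) ^ 2 := by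
  have h := (summable_nat_add_iff 1).2 (Real.summable_one_div_nat_pow (p := 2) |>.2 (by omega))
  simpa using h

lemma Cl2_cont : Continuous Cl2 := by
  refine continuous_tsum (u := fun n : ℕ => 1 / ((n : ℝ) + 1) ^ 2) (fun k => by fun_prop) sq_summable ?_
  intro n x
  rw [norm_div, norm_pow, Real.norm_eq_abs, Real.norm_eq_abs, abs_of_nonneg (by positivity : (0 : ℝ) ≤ (n : ℝ) + 1)]
  gcongr
  exact Real.abs_sin_le_one _

noncomputable def ClR (r x : ℝ) : ℝ :=
  ∑' k : ℕ, r ^ (k + 1) * Real.sin (((k : ℝ) + 1) * x) / ((k : ℝ) + 1) ^ 2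

lemma cos_sum {r : ℝ} (h0 : 0 ≤ r) (h1 : r < 1) (x : ℝ) :
    HasSum (fun k : ℕ => r ^ (k + 1) * Real.cos (((k : ℝ) + 1) * x) / ((k : ℝ) + 1))
      (-(Real.log (1 - 2 * r * Real.cos x + r ^ 2) / 2)) := by
  have hn : ‖(r : ℂ) * Complex.exp (x * I)‖ < 1 := by
    rw [norm_mul, Complex.norm_exp_ofReal_mul_I, Complex.norm_real, Real.norm_eq_abs, abs_of_nonneg h0]
    simpa using h1
  have h := Complex.hasSum_re (Complex.hasSum_taylorSeries_neg_log' hn)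
  convert h using 1
  · ext k
    rw [mul_pow, ← Complex.exp_nat_mul]
    have : ((k + 1 : ℕ) : ℂ) * (x * I) = ((((k : ℝ) + 1) * x : ℝ) : ℂ) * I := by push_cast; ring
    rw [this, ← Complex.ofReal_pow]
    have h2 : ((k : ℂ) + 1) = (((k : ℝ) + 1 : ℝ) : ℂ) := by push_cast; rfl
    rw [h2, Complex.div_ofReal_re, Complex.re_ofReal_mul, Complex.exp_ofReal_mul_I_re]
  · rw [Complex.neg_re, Complex.log_re]
    have : 1 - 2 * r * Real.cos x + r ^ 2 = ‖1 - (r : ℂ) * Complex.exp (x * I)‖ ^ 2 := by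
      rw [← Complex.normSq_eq_norm_sq, Complex.normSq_apply]
      simp only [Complex.sub_re, Complex.sub_im, Complex.one_re, Complex.one_im, Complex.re_ofReal_mul,
        Complex.im_ofReal_mul, Complex.exp_ofReal_mul_I_re, Complex.exp_ofReal_mul_I_im]
      nlinarith [Real.sin_sq_add_cos_sq x]
    rw [this, Real.log_pow]
    push_cast; ring

lemma ClR_deriv {r : ℝ} (h0 : 0 ≤ r) (h1 : r < 1) (x : ℝ) :
    HasDerivAt (ClR r) (-(Real.log (1 - 2 * r * Real.cos x + r ^ 2) / 2)) x := by
  rw [← (cos_sum h0 h1 x).tsum_eq]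
  refine hasDerivAt_tsum (u := fun k : ℕ => r ^ k * r)
    (g := fun k x => r ^ (k + 1) * Real.sin (((k : ℝ) + 1) * x) / ((k : ℝ) + 1) ^ 2)
    (g' := fun k x => r ^ (k + 1) * Real.cos (((k : ℝ) + 1) * x) / ((k : ℝ) + 1)) (y₀ := 0)
    ((summable_geometric_of_lt_one h0 h1).mul_right r) ?_ ?_ ?_ x
  · intro k y
    have := ((((hasDerivAt_id y).const_mul ((k : ℝ) + 1)).sin).const_mul (r ^ (k + 1))).div_const (((k : ℝ) + 1) ^ 2)
    refine this.congr_deriv ?_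
    simp only [id]
    field_simp
  · intro k y
    rw [← pow_succ, Real.norm_eq_abs, abs_div, abs_mul, abs_of_nonneg (by positivity : (0 : ℝ) ≤ (k : ℝ) + 1),
      abs_of_nonneg (by positivity : (0 : ℝ) ≤ r ^ (k + 1)), div_le_iff₀ (by positivity)]
    have a := Real.abs_cos_le_one (((k : ℝ) + 1) * y)
    have : (1 : ℝ) ≤ (k : ℝ) + 1 := by linarith [Nat.cast_nonneg (α := ℝ) k]
    gcongr
    linarith
  · simp [summable_zero]

lemma ClR_tendsto (x : ℝ) : Filter.Tendsto (fun r => ClR r x) (nhdsWithin 1 (Set.Ioo 0 1)) (nhds (Cl2 x)) := by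
  refine tendsto_tsum_of_dominated_convergence (bound := fun n : ℕ => 1 / ((n : ℝ) + 1) ^ 2) sq_summable ?_ ?_
  · intro k
    have : Continuous fun r : ℝ => r ^ (k + 1) * Real.sin (((k : ℝ) + 1) * x) / ((k : ℝ) + 1) ^ 2 := by fun_prop
    have h := this.tendsto 1
    simp only [one_pow, one_mul] at h
    exact h.mono_left nhdsWithin_le_nhds
  · filter_upwards [self_mem_nhdsWithin] with r hr k
    rw [norm_div, norm_mul, norm_pow, norm_pow, Real.norm_eq_abs, Real.norm_eq_abs, Real.norm_eq_abs,
      abs_of_nonneg (by positivity : (0 : ℝ) ≤ (k : ℝ) + 1), abs_of_pos hr.1]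
    gcongr
    exact mul_le_one₀ (pow_le_one₀ hr.1.le hr.2.le) (abs_nonneg _) (Real.abs_sin_le_one _)

lemma quad_pos {r x : ℝ} (hr : 0 ≤ r) (hx0 : 0 < x) (hx1 : x < 2 * π) : 0 < 1 - 2 * r * Real.cos x + r ^ 2 := by
  have hc : Real.cos x < 1 := by
    have := Real.sin_pos_of_pos_of_lt_pi (x := x / 2) (by linarith) (by linarith)
    have e : Real.cos x = 1 - 2 * Real.sin (x / 2) ^ 2 := by
      have := Real.cos_sq' (x / 2)
      have h2 := Real.cos_two_mul (x / 2)
      rw [show 2 * (x / 2) = x by ring] at h2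
      linarith
    nlinarith
  rcases hr.eq_or_lt with rfl | h
  · simp
  · nlinarith [sq_nonneg (1 - r), mul_pos h (sub_pos.2 hc)]

lemma Cl2_int {a b : ℝ} (ha : 0 < a) (hab : a ≤ b) (hb : b < 2 * π) :
    ∫ x in a..b, -(Real.log (1 - 2 * 1 * Real.cos x + 1 ^ 2) / 2) = Cl2 b - Cl2 a := by
  have hcont : ContinuousOn (fun p : ℝ × ℝ => -(Real.log (1 - 2 * p.1 * Real.cos p.2 + p.1 ^ 2) / 2))
      (Set.Icc 0 1 ×ˢ Set.Icc a b) := by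
    refine ContinuousOn.neg (ContinuousOn.div_const (ContinuousOn.log (by fun_prop) ?_) _)
    rintro ⟨r, x⟩ ⟨hr, hx⟩
    exact (quad_pos hr.1 (ha.trans_le hx.1) (hx.2.trans_lt hb)).ne'
  obtain ⟨M, hM⟩ := (isCompact_Icc.prod isCompact_Icc).exists_bound_of_continuousOn hcont
  have hslice : ∀ r ∈ Set.Icc (0 : ℝ) 1, ContinuousOn
      (fun x => -(Real.log (1 - 2 * r * Real.cos x + r ^ 2) / 2)) (Set.Icc a b) := by
    intro r hr
    exact hcont.comp (f := fun x => (r, x)) (by fun_prop) (fun x hx => ⟨hr, hx⟩)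
  have : Filter.NeBot (nhdsWithin (1 : ℝ) (Set.Ioo 0 1)) := right_nhdsWithin_Ioo_neBot (by norm_num)
  have h1 : Filter.Tendsto (fun r => ∫ x in a..b, -(Real.log (1 - 2 * r * Real.cos x + r ^ 2) / 2))
      (nhdsWithin 1 (Set.Ioo 0 1))
      (nhds (∫ x in a..b, -(Real.log (1 - 2 * 1 * Real.cos x + 1 ^ 2) / 2))) := by
    refine intervalIntegral.tendsto_integral_filter_of_dominated_convergence (fun _ => M) ?_ ?_ (by simp) ?_
    · filter_upwards [self_mem_nhdsWithin] with r hr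
      rw [Set.uIoc_of_le hab]
      exact ((hslice r ⟨hr.1.le, hr.2.le⟩).mono Set.Ioc_subset_Icc_self).aestronglyMeasurable measurableSet_Ioc
    · filter_upwards [self_mem_nhdsWithin] with r hr
      refine Filter.Eventually.of_forall fun x hx => ?_
      rw [Set.uIoc_of_le hab] at hx
      exact hM (r, x) ⟨⟨hr.1.le, hr.2.le⟩, Set.Ioc_subset_Icc_self hx⟩
    · refine Filter.Eventually.of_forall fun x hx => ?_
      rw [Set.uIoc_of_le hab] at hx
      have hp := (quad_pos (r := 1) (by norm_num) (ha.trans hx.1) (hx.2.trans_lt hb)).ne'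
      have : ContinuousAt (fun r : ℝ => -(Real.log (1 - 2 * r * Real.cos x + r ^ 2) / 2)) 1 :=
        ContinuousAt.neg (ContinuousAt.div_const
          (ContinuousAt.log (f := fun r : ℝ => 1 - 2 * r * Real.cos x + r ^ 2) (by fun_prop) hp) _)
      exact this.tendsto.mono_left nhdsWithin_le_nhds
  have h2 := (ClR_tendsto b).sub (ClR_tendsto a)
  refine tendsto_nhds_unique (h1.congr' ?_) h2
  filter_upwards [self_mem_nhdsWithin] with r hr
  refine intervalIntegral.integral_eq_sub_of_hasDerivAt (fun x _ => ClR_deriv hr.1.le hr.2 x) ?_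
  refine ContinuousOn.intervalIntegrable ?_
  rw [Set.uIcc_of_le hab]
  exact hslice r ⟨hr.1.le, hr.2.le⟩

lemma Cl2_deriv {x : ℝ} (h0 : 0 < x) (h1 : x < 2 * π) :
    HasDerivAt Cl2 (-Real.log (2 * Real.sin (x / 2))) x := by
  set f : ℝ → ℝ := fun x => -(Real.log (1 - 2 * 1 * Real.cos x + 1 ^ 2) / 2) with hf
  have hfc : ContinuousOn f (Set.Ioo 0 (2 * π)) := by
    refine ContinuousOn.neg (ContinuousOn.div_const (ContinuousOn.log (by fun_prop) ?_) _)
    intro y hy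
    exact (quad_pos (by norm_num) hy.1 hy.2).ne'
  have hv : f x = -Real.log (2 * Real.sin (x / 2)) := by
    have e : 1 - 2 * 1 * Real.cos x + 1 ^ 2 = (2 * Real.sin (x / 2)) ^ 2 := by
      have := Real.cos_sq' (x / 2)
      have h2 := Real.cos_two_mul (x / 2)
      rw [show 2 * (x / 2) = x by ring] at h2
      linarith
    rw [hf]
    simp only
    rw [e, Real.log_pow]
    push_cast; ring
  rw [← hv]
  have hd : HasDerivAt (fun u => ∫ t in (x / 2)..u, f t) (f x) x := by
    refine intervalIntegral.integral_hasDerivAt_right ?_ ?_ ?_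
    · refine ContinuousOn.intervalIntegrable (hfc.mono ?_)
      rw [Set.uIcc_of_le (by linarith)]
      intro y hy
      exact ⟨by linarith [hy.1], by linarith [hy.2]⟩
    · exact hfc.stronglyMeasurableAtFilter isOpen_Ioo x ⟨h0, h1⟩
    · exact hfc.continuousAt (Ioo_mem_nhds h0 h1)
  refine (hd.add_const (Cl2 (x / 2))).congr_of_eventuallyEq ?_
  filter_upwards [Ioo_mem_nhds (by linarith : x / 2 < x) h1] with y hy
  rw [Cl2_int (by linarith) hy.1.le hy.2]
  ring

lemma sin_pos' {z : ℝ} (h0 : 0 < z) (h1 : z < 1) : 0 < Real.sin (π * z) :=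
  Real.sin_pos_of_pos_of_lt_pi (by positivity) (by nlinarith [Real.pi_pos])

lemma log_cont {b : ℝ} (hb : b < 1) :
    ContinuousOn (fun z : ℝ => z * Real.log (2 * Real.sin (π * z))) (Set.Icc 0 b) := by
  have hpos : ∀ z ∈ Set.Icc 0 b, 0 < 2 * π * Real.sinc (π * z) := by
    intro z hz
    rcases hz.1.eq_or_lt with rfl | h
    · simp [Real.pi_pos]
    · rw [Real.sinc_of_ne_zero (by positivity)]
      have := sin_pos' h (hz.2.trans_lt hb)
      positivity
  have : ContinuousOn (fun z : ℝ => z * Real.log z + z * Real.log (2 * π * Real.sinc (π * z))) (Set.Icc 0 b) := by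
    refine Real.continuous_mul_log.continuousOn.add (continuousOn_id.mul (ContinuousOn.log ?_ fun z hz => (hpos z hz).ne'))
    exact (continuous_const.mul (Real.continuous_sinc.comp (continuous_const.mul continuous_id))).continuousOn
  refine this.congr fun z hz => ?_
  rcases hz.1.eq_or_lt with rfl | h
  · simp
  · have hp := hpos z hz
    have e : 2 * Real.sin (π * z) = z * (2 * π * Real.sinc (π * z)) := by
      rw [Real.sinc_of_ne_zero (by positivity)]
      field_simp
    simp only
    rw [e, Real.log_mul h.ne' hp.ne']
    ring

lemma oddS_eq {z : ℝ} (h0 : 0 < z) (h1 : z < 1) :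
    oddS z = z / 2 - z * Real.log (2 * Real.sin (π * z)) / 2 - Cl2 (2 * π * z) / (4 * π) := by
  have hc : ContinuousOn (fun z => oddS z -
      (z / 2 - z * Real.log (2 * Real.sin (π * z)) / 2 - Cl2 (2 * π * z) / (4 * π))) (Set.Icc 0 z) := by
    refine ContinuousOn.sub (fun y hy => (oddS_deriv ?_).continuousAt.continuousWithinAt) ?_
    · rw [abs_of_nonneg hy.1]; exact hy.2.trans_lt h1
    · refine ((continuousOn_id.div_const _).sub ((log_cont h1).div_const _)).sub ?_
      exact ((Cl2_cont.comp (continuous_const.mul continuous_id)).div_const _).continuousOn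
  obtain ⟨c, -, hc⟩ := exists_hasDerivAt_eq_slope _ (fun _ => 0) h0 hc (fun x hx => by
    have hx1 : x < 1 := hx.2.trans h1
    have hs := sin_pos' hx.1 hx1
    have d1 := oddS_deriv (x := x) (by rw [abs_of_pos hx.1]; exact hx1)
    rw [evenZ_gen hx.1 hx1] at d1
    have d2 : HasDerivAt (fun z : ℝ => Real.log (2 * Real.sin (π * z)))
        (2 * (Real.cos (π * x) * (π * 1)) / (2 * Real.sin (π * x))) x :=
      ((((hasDerivAt_id x).const_mul π).sin).const_mul 2).log (by simp only [id]; positivity)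
    have d3 : HasDerivAt (fun z : ℝ => Cl2 (2 * π * z))
        (-Real.log (2 * Real.sin (2 * π * x / 2)) * (2 * π * 1)) x :=
      (Cl2_deriv (x := 2 * π * x) (by have := hx.1; positivity) (by nlinarith [Real.pi_pos])).comp x
        ((hasDerivAt_id x).const_mul (2 * π))
    refine (d1.sub ((((hasDerivAt_id x).div_const 2).sub (((hasDerivAt_id x).mul d2).div_const 2)).sub
      (d3.div_const (4 * π)))).congr_deriv ?_
    rw [show 2 * π * x / 2 = π * x by ring]
    simp only [id]
    field_simp
    ring)
  have e0 : oddS 0 = 0 := by simp [oddS]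
  have e1 : Cl2 0 = 0 := by simp [Cl2]
  have := (div_eq_zero_iff.1 hc.symm).resolve_right (by linarith)
  simp only [e0, mul_zero, e1] at this
  norm_num at this
  linarith

lemma real_pos {z : ℝ} (h0 : 0 < z) (h1 : z < 1) :
    ∑' k : ℕ, evenZ k * z ^ (2 * (k + 1)) / (2 * ((k : ℝ) + 1) + 1)
      = 1 / 2 - (1 / 2) * Real.log (2 * Real.sin (π * z)) - Cl2 (2 * π * z) / (4 * π * z) := by
  have h := oddS_eq h0 h1
  have e : oddS z = z * ∑' k : ℕ, evenZ k * z ^ (2 * (k + 1)) / (2 * ((k : ℝ) + 1) + 1) := by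
    rw [oddS, ← tsum_mul_left]
    congr 1; funext k; ring
  rw [e] at h
  have := Real.pi_pos
  apply mul_left_cancel₀ h0.ne'
  rw [h]
  field_simp

lemma Cl2_neg (x : ℝ) : Cl2 (-x) = -Cl2 x := by
  simp only [Cl2]
  rw [← tsum_neg]
  congr 1; funext k
  rw [mul_neg, Real.sin_neg, neg_div]

lemma real_all {z : ℝ} (hz : 0 < |z|) (hz1 : |z| < 1) :
    ∑' k : ℕ, evenZ k * z ^ (2 * (k + 1)) / (2 * ((k : ℝ) + 1) + 1)
      = 1 / 2 - (1 / 2) * Real.log (2 * Real.sin (π * z)) - Cl2 (2 * π * z) / (4 * π * z) := by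
  rcases lt_or_gt_of_ne (abs_pos.1 hz) with h | h
  · rw [abs_of_neg h] at hz hz1
    have := real_pos hz hz1
    simp only [mul_neg, Real.sin_neg, Cl2_neg, Real.log_neg_eq_log, neg_div_neg_eq] at this
    rw [← this]
    congr 1; funext k
    rw [Even.neg_pow (even_two_mul _)]
  · rw [abs_of_pos h] at hz1
    exact real_pos h hz1

theorem stmt18 (z : ℝ) (hz : 0 < |z|) (hz1 : |z| < 1) :
    ∑' k : ℕ, riemannZeta (2 * ((k : ℂ) + 1)) * (z : ℂ) ^ (2 * (k + 1))
        / (2 * ((k : ℂ) + 1) + 1)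
      = 1 / 2 - (1 / 2) * Real.log (2 * Real.sin (π * z)) - (Cl2 (2 * π * z) : ℂ) / (4 * π * z) := by
  have h := congrArg (fun x : ℝ => (x : ℂ)) (real_all hz hz1)
  simp only [Complex.ofReal_tsum] at h
  simp only [evenZ_eq]
  push_cast at h ⊢
  exact h
end
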